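/- There exists a tiling of the hyperbolic plane admitting a uniform plane-filling path in the following sense: in the upper half-plane model ℍ of the hyperbolic plane (with its hyperbolic metric), there is a family of subsets (T n), indexed by the integers n ∈ ℤ, such that (i) each T n is compact with nonempty interior; (ii) any two tiles T m and T n are isometric (there is a surjective isometry of ℍ carrying T m onto T n); (iii) the interiors of distinct tiles are pairwise disjoint; (iv) the union of all the tiles T n is all of ℍ; and (v) for every n ∈ ℤ, consecutive tiles are adjacent, i.e. T n ∩ T (n+1) is nonempty. (This renders the paper's Theorem 1: there is a uniform plane-filling path for the ternary heptagrid of the hyperbolic plane, i.e. a path visiting every tile of the tessellation exactly once, indexed bi-infinitely and not forming a cycle, consecutive tiles along the path being adjacent.) -/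

import Mathlib

open UpperHalfPlane

section Paths

variable {α : Type*} {r : α → α → Prop}

/-- `S` is a finite set whose elements can be listed without repetition, from `a` to `b`, in such
a way that consecutive elements are related by `r`. -/
def HasPath (r : α → α → Prop) (S : Set α) (a b : α) : Prop :=
  ∃ l : List α, l.IsChain r ∧ l.Nodup ∧ (∀ v, v ∈ l ↔ v ∈ S) ∧
    l.head? = some a ∧ l.getLast? = some b

theorem HasPath.singleton (a : α) : HasPath r {a} a a :=
  ⟨[a], by simp, by simp, by simp, by simp, by simp⟩

theorem HasPath.append {S S' : Set α} {a b c d : α} (h : HasPath r S a b)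
    (h' : HasPath r S' c d) (hbc : r b c) (hd : Disjoint S S') :
    HasPath r (S ∪ S') a d := by
  obtain ⟨l, h1, h2, h3, h4, h5⟩ := h
  obtain ⟨l', h1', h2', h3', h4', h5'⟩ := h'
  refine ⟨l ++ l', ?_, ?_, ?_, ?_, ?_⟩
  · rw [List.isChain_append]
    refine ⟨h1, h1', ?_⟩
    intro x hx y hy
    simp_all
  · refine h2.append h2' ?_
    intro v hv hv'
    exact Set.disjoint_left.1 hd ((h3 v).1 hv) ((h3' v).1 hv')
  · simp [h3, h3']
  · simp [List.head?_append, h4]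
  · simp [List.getLast?_append, h5']

theorem HasPath.symm (hr : ∀ x y, r x y → r y x) {S : Set α} {a b : α} (h : HasPath r S a b) :
    HasPath r S b a := by
  obtain ⟨l, h1, h2, h3, h4, h5⟩ := h
  refine ⟨l.reverse, ?_, List.nodup_reverse.2 h2, by simpa using h3, by simpa using h5,
    by simpa using h4⟩
  rw [List.isChain_reverse]
  exact h1.imp fun x y => hr x y

/-- If a type is exhausted by an increasing sequence of sets such that the successive differences
are traversed by finite paths that can be glued end to end, then it is traversed by a one-way
infinite path. -/
theorem exists_bijective_of_hasPath {R S : ℕ → Set α} {b c : ℕ → α} {a : α}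
    (h0 : HasPath r (R 0) a (b 0)) (hS : ∀ n, HasPath r (S n) (c n) (b (n + 1)))
    (hbc : ∀ n, r (b n) (c n)) (hR : ∀ n, R (n + 1) = R n ∪ S n)
    (hd : ∀ n, Disjoint (R n) (S n)) (hcover : ∀ v, ∃ n, v ∈ R n) :
    ∃ f : ℕ → α, Function.Bijective f ∧ f 0 = a ∧ ∀ n, r (f n) (f (n + 1)) := by
  obtain ⟨l₀, k1, k2, k3, k4, k5⟩ := h0
  choose l h1 h2 h3 h4 h5 using hS
  let L : ℕ → List α := fun n => Nat.rec l₀ (fun n x => x ++ l n) n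
  have L0 : L 0 = l₀ := rfl
  have Ls : ∀ n, L (n + 1) = L n ++ l n := fun n => rfl
  have Lprefix : ∀ m n, m ≤ n → L m <+: L n := by
    intro m n hmn
    induction n, hmn using Nat.le_induction with
    | base => exact List.prefix_rfl
    | succ n _ ih => exact ih.trans ⟨l n, rfl⟩
  have Llen : ∀ n, n < (L n).length := by
    intro n
    induction n with
    | zero => rw [L0]; cases l₀ <;> simp_all
    | succ n ih =>
      have : l n ≠ [] := by intro h; simpa [h] using h4 n
      have := List.length_pos_iff.2 this
      rw [Ls, List.length_append]; omega
  have Lmem : ∀ n v, v ∈ L n ↔ v ∈ R n := by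
    intro n
    induction n with
    | zero => exact k3
    | succ n ih => intro v; rw [Ls, List.mem_append, ih, h3, hR]; rfl
  have Lnodup : ∀ n, (L n).Nodup := by
    intro n
    induction n with
    | zero => exact k2
    | succ n ih =>
      rw [Ls]
      refine ih.append (h2 n) ?_
      intro v hv hv'
      exact Set.disjoint_left.1 (hd n) ((Lmem n v).1 hv) ((h3 n v).1 hv')
  have Llast : ∀ n, (L n).getLast? = some (b n) := by
    intro n
    induction n with
    | zero => exact k5
    | succ n ih => rw [Ls]; simp [List.getLast?_append, h5]
  have Lchain : ∀ n, (L n).IsChain r := by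
    intro n
    induction n with
    | zero => exact k1
    | succ n ih =>
      rw [Ls, List.isChain_append]
      refine ⟨ih, h1 n, ?_⟩
      intro x hx y hy
      have hx' := Llast n
      have hy' := h4 n
      have := hbc n
      simp_all
  have key : ∀ n i (h : i < (L n).length), (L i)[i]'(Llen i) = (L n)[i] := by
    intro n i h
    rcases le_total i n with hin | hin
    · exact (Lprefix i n hin).getElem _
    · exact ((Lprefix n i hin).getElem _).symm
  refine ⟨fun i => (L i)[i]'(Llen i), ⟨?_, ?_⟩, ?_, ?_⟩
  · intro i j hij
    have hi : i < (L (max i j)).length := (le_max_left i j).trans_lt (Llen _)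
    have hj : j < (L (max i j)).length := (le_max_right i j).trans_lt (Llen _)
    simp only [key _ _ hi, key _ _ hj] at hij
    exact ((Lnodup _).getElem_inj_iff).1 hij
  · intro v
    obtain ⟨n, hn⟩ := hcover v
    obtain ⟨i, hi, hv⟩ := List.getElem_of_mem ((Lmem n v).2 hn)
    exact ⟨i, by simp only [key _ _ hi, hv]⟩
  · cases l₀ <;> simp_all
  · intro n
    have hn : n + 1 < (L (n + 1)).length := Llen _
    simp only [key (n + 1) n (by omega)]
    exact List.isChain_iff_getElem.1 (Lchain (n + 1)) n hn

end Paths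

section Quadrant

/-- Adjacency of the binary tiling, restricted to the tiles on one side of a vertical geodesic:
`(k, j)` is the `j`-th tile of the `k`-th horocyclic row. -/
def BinaryAdj (p q : ℤ × ℕ) : Prop :=
  (q.1 = p.1 ∧ q.2 = p.2 + 1) ∨ (p.1 = q.1 ∧ p.2 = q.2 + 1) ∨
  (q.1 = p.1 - 1 ∧ (q.2 = 2 * p.2 ∨ q.2 = 2 * p.2 + 1)) ∨
  (p.1 = q.1 - 1 ∧ (p.2 = 2 * q.2 ∨ p.2 = 2 * q.2 + 1))

theorem BinaryAdj.symm {p q : ℤ × ℕ} (h : BinaryAdj p q) : BinaryAdj q p := by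
  unfold BinaryAdj at *
  tauto

theorem hasPath_row (k : ℤ) {p q : ℕ} (hpq : p ≤ q) :
    HasPath BinaryAdj {v | v.1 = k ∧ p ≤ v.2 ∧ v.2 ≤ q} (k, p) (k, q) := by
  induction q, hpq using Nat.le_induction with
  | base =>
    convert HasPath.singleton (r := BinaryAdj) (k, p) using 1
    ext ⟨x, y⟩
    simp
    omega
  | succ q hq ih =>
    convert ih.append (HasPath.singleton (k, q + 1)) (by simp [BinaryAdj]) ?_ using 1
    · ext ⟨x, y⟩
      simp
      omega
    · simp

/-- The `m + 1` top rows of the descendants of the tile `(n, 1)` of the binary tiling. -/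
def descendants (n : ℤ) (m : ℕ) : Set (ℤ × ℕ) :=
  {v | ∃ i ≤ m, v.1 = n - i ∧ 2 ^ i ≤ v.2 ∧ v.2 < 2 ^ (i + 1)}

theorem descendants_succ (n : ℤ) (m : ℕ) : descendants n (m + 1) =
    descendants n m ∪ {v | v.1 = n - (m + 1 : ℕ) ∧ 2 ^ (m + 1) ≤ v.2 ∧ v.2 ≤ 2 ^ (m + 2) - 1} := by
  have h : 0 < 2 ^ (m + 2) := by positivity
  ext v
  simp only [descendants, Set.mem_union, Set.mem_ofPred_eq, Nat.le_add_one_iff]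
  constructor
  · rintro ⟨i, hi | rfl, h⟩
    · exact Or.inl ⟨i, hi, h⟩
    · exact Or.inr ⟨h.1, h.2.1, Nat.le_sub_one_of_lt h.2.2⟩
  · rintro (⟨i, hi, h⟩ | h)
    · exact ⟨i, Or.inl hi, h⟩
    · exact ⟨m + 1, Or.inr rfl, h.1, h.2.1, by show v.2 < 2 ^ (m + 2); omega⟩

theorem hasPath_descendants (n : ℤ) (m : ℕ) :
    HasPath BinaryAdj (descendants n m) (n, 1) (n - m, 2 ^ m) ∧
    HasPath BinaryAdj (descendants n m) (n, 1) (n - m, 2 ^ (m + 1) - 1) := by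
  induction m with
  | zero =>
    have : descendants n 0 = {(n, 1)} := by
      ext ⟨x, y⟩
      simp [descendants]
      omega
    simpa [this] using HasPath.singleton (r := BinaryAdj) (n, 1)
  | succ m ih =>
    have h1 : 1 ≤ 2 ^ m := Nat.one_le_two_pow
    have h2 : 2 ^ (m + 1) = 2 * 2 ^ m := by ring
    have h3 : 2 ^ (m + 2) = 4 * 2 ^ m := by ring
    have hrow := hasPath_row (n - (m + 1 : ℕ)) (p := 2 ^ (m + 1)) (q := 2 ^ (m + 2) - 1) (by omega)
    have hd : Disjoint (descendants n m)
        {v | v.1 = n - (m + 1 : ℕ) ∧ 2 ^ (m + 1) ≤ v.2 ∧ v.2 ≤ 2 ^ (m + 2) - 1} := by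
      rw [Set.disjoint_left]
      rintro v ⟨i, hi, h, -⟩ ⟨h', -⟩
      omega
    rw [descendants_succ]
    refine ⟨ih.2.append (hrow.symm fun _ _ => BinaryAdj.symm) ?_ hd, ih.1.append hrow ?_ hd⟩ <;>
    · simp only [BinaryAdj]
      omega

/-- The tiles of the quadrant lying in the rows from `-n` to `n` and below `(n, 0)`. -/
def quadrantBox (n : ℕ) : Set (ℤ × ℕ) :=
  {v | ∃ i ≤ 2 * n, v.1 = n - i ∧ v.2 < 2 ^ i}

/-- The tiles to be added to `quadrantBox n` in order to obtain `quadrantBox (n + 1)`. -/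
def quadrantShell (n : ℕ) : Set (ℤ × ℕ) :=
  {((n + 1 : ℤ), 0)} ∪ descendants n (2 * n) ∪
    {v | v.1 = -(n + 1 : ℤ) ∧ 0 ≤ v.2 ∧ v.2 ≤ 2 ^ (2 * n + 2) - 1}

theorem hasPath_quadrantShell (n : ℕ) :
    HasPath BinaryAdj (quadrantShell n) ((n + 1 : ℤ), 0) (-(n + 1 : ℤ), 0) := by
  have h1 : 1 ≤ 2 ^ (2 * n) := Nat.one_le_two_pow
  have h2 : 2 ^ (2 * n + 1) = 2 * 2 ^ (2 * n) := by ring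
  have h3 : 2 ^ (2 * n + 2) = 4 * 2 ^ (2 * n) := by ring
  refine ((HasPath.singleton _).append (hasPath_descendants n (2 * n)).2 ?_ ?_).append
    ((hasPath_row _ (Nat.zero_le _)).symm fun _ _ => BinaryAdj.symm) ?_ ?_
  · simp [BinaryAdj]
  · rw [Set.disjoint_left]
    rintro _ rfl ⟨i, hi, h, -⟩
    simp only at h
    omega
  · simp only [BinaryAdj]
    push_cast
    omega
  · rw [Set.disjoint_left]
    rintro v (rfl | ⟨i, hi, h, -⟩) ⟨h', -⟩
    · simp only at h'
      omega
    · omega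

theorem quadrantBox_succ (n : ℕ) : quadrantBox (n + 1) = quadrantBox n ∪ quadrantShell n := by
  ext ⟨k, j⟩
  simp only [quadrantBox, quadrantShell, descendants, Set.mem_union, Set.mem_ofPred_eq,
    Set.mem_singleton_iff, Prod.mk.injEq]
  have hp : 0 < 2 ^ (2 * n + 2) := by positivity
  constructor
  · rintro ⟨i, hi, hk, hj⟩
    rcases i with _ | i
    · right; left; left
      push_cast at hk
      simp at hj
      omega
    · push_cast at hk
      by_cases hi' : i ≤ 2 * n
      · by_cases hj' : j < 2 ^ i
        · exact Or.inl ⟨i, hi', by omega, hj'⟩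
        · exact Or.inr (Or.inl (Or.inr ⟨i, hi', by omega, by omega, hj⟩))
      · obtain rfl : i = 2 * n + 1 := by omega
        right; right
        push_cast at hk
        exact ⟨by omega, Nat.zero_le _, Nat.le_sub_one_of_lt hj⟩
  · rintro (⟨i, hi, hk, hj⟩ | (⟨hk, hj⟩ | ⟨i, hi, hk, -, hj⟩) | ⟨hk, -, hj⟩)
    · exact ⟨i + 1, by omega, by push_cast; omega, by rw [pow_succ]; omega⟩
    · exact ⟨0, by omega, by push_cast; omega, by simp [hj]⟩
    · exact ⟨i + 1, by omega, by push_cast; omega, hj⟩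
    · exact ⟨2 * n + 2, by omega, by push_cast; omega, by omega⟩

theorem disjoint_quadrantBox_quadrantShell (n : ℕ) :
    Disjoint (quadrantBox n) (quadrantShell n) := by
  rw [Set.disjoint_left]
  rintro ⟨k, j⟩ ⟨i, hi, hk, hj⟩ ((h | ⟨i', hi', hk', hj', -⟩) | ⟨hk', -⟩)
  · simp only [Set.mem_singleton_iff, Prod.mk.injEq] at h hk
    omega
  · simp only at hk hk' hj hj'
    obtain rfl : i = i' := by omega
    omega
  · simp only at hk hk'
    omega

theorem exists_mem_quadrantBox (v : ℤ × ℕ) : ∃ n, v ∈ quadrantBox n := by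
  obtain ⟨k, j⟩ := v
  refine ⟨k.natAbs + j, (((k.natAbs + j : ℕ) : ℤ) - k).toNat, by omega, by simp only; omega, ?_⟩
  calc j < 2 ^ j := Nat.lt_two_pow_self
    _ ≤ _ := Nat.pow_le_pow_right (by norm_num) (by omega)

/-- The tiles of one quadrant of the binary tiling are enumerated by a one-way infinite path. -/
theorem exists_quadrant_path :
    ∃ f : ℕ → ℤ × ℕ, Function.Bijective f ∧ f 0 = (0, 0) ∧
      ∀ n, BinaryAdj (f n) (f (n + 1)) := by
  refine exists_bijective_of_hasPath (R := quadrantBox) (S := quadrantShell)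
    (b := fun n => ((-1) ^ n * (n : ℤ), 0)) (c := fun n => ((-1) ^ n * (n + 1 : ℤ), 0))
    ?_ ?_ ?_ quadrantBox_succ disjoint_quadrantBox_quadrantShell exists_mem_quadrantBox
  · have : quadrantBox 0 = {(0, 0)} := by
      ext ⟨x, y⟩
      simp [quadrantBox]
    simpa [this] using HasPath.singleton (r := BinaryAdj) (0, 0)
  · intro n
    have h := hasPath_quadrantShell n
    rcases Nat.even_or_odd n with hn | hn
    · simpa [hn.neg_one_pow, pow_succ] using h
    · simpa [hn.neg_one_pow, pow_succ] using h.symm fun _ _ => BinaryAdj.symm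
  · intro n
    rcases Nat.even_or_odd n with hn | hn
    · simp [hn.neg_one_pow, BinaryAdj]
    · simp [hn.neg_one_pow, BinaryAdj]
      omega

end Quadrant

section Tiles

/-- The tile of the binary tiling of `ℍ` with lower left corner `2 ^ k * (j + i)`. -/
def binaryTile (k j : ℤ) : Set ℍ :=
  {z | (z.re ∈ Set.Icc ((2 : ℝ) ^ k * j) (2 ^ k * (j + 1))) ∧
    z.im ∈ Set.Icc ((2 : ℝ) ^ k) (2 ^ (k + 1))}

theorem image_coe_binaryTile (k j : ℤ) : ((↑) : ℍ → ℂ) '' binaryTile k j =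
    Set.Icc ((2 : ℝ) ^ k * j) (2 ^ k * (j + 1)) ×ℂ Set.Icc ((2 : ℝ) ^ k) (2 ^ (k + 1)) := by
  ext w
  rw [Complex.mem_reProdIm]
  constructor
  · rintro ⟨z, hz, rfl⟩
    exact hz
  · intro hw
    have hpos : 0 < w.im := lt_of_lt_of_le (by positivity) hw.2.1
    exact ⟨⟨w, hpos⟩, hw, rfl⟩

theorem isCompact_binaryTile (k j : ℤ) : IsCompact (binaryTile k j) := by
  rw [UpperHalfPlane.isOpenEmbedding_coe.isEmbedding.isCompact_iff, image_coe_binaryTile]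
  exact isCompact_Icc.reProdIm isCompact_Icc

theorem mem_interior_binaryTile {k j : ℤ} {z : ℍ} : z ∈ interior (binaryTile k j) ↔
    z.re ∈ Set.Ioo ((2 : ℝ) ^ k * j) (2 ^ k * (j + 1)) ∧
      z.im ∈ Set.Ioo ((2 : ℝ) ^ k) (2 ^ (k + 1)) := by
  constructor
  · intro hz
    have h := UpperHalfPlane.isOpenEmbedding_coe.isOpenMap.image_interior_subset _
      (Set.mem_image_of_mem _ hz)
    rwa [image_coe_binaryTile, Complex.interior_reProdIm, interior_Icc, interior_Icc,
      Complex.mem_reProdIm] at h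
  · intro hz
    let U : Set ℍ := UpperHalfPlane.re ⁻¹' Set.Ioo ((2 : ℝ) ^ k * j) (2 ^ k * (j + 1)) ∩
      UpperHalfPlane.im ⁻¹' Set.Ioo ((2 : ℝ) ^ k) (2 ^ (k + 1))
    have hU : IsOpen U := (isOpen_Ioo.preimage UpperHalfPlane.continuous_re).inter
      (isOpen_Ioo.preimage UpperHalfPlane.continuous_im)
    have hsub : U ⊆ binaryTile k j := fun w hw =>
      ⟨Set.Ioo_subset_Icc_self hw.1, Set.Ioo_subset_Icc_self hw.2⟩
    exact interior_maximal hsub hU hz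

theorem nonempty_interior_binaryTile (k j : ℤ) : (interior (binaryTile k j)).Nonempty := by
  have h : (0 : ℝ) < 2 ^ k := by positivity
  have h' : (2 : ℝ) ^ (k + 1) = 2 ^ k * 2 := zpow_add_one₀ two_ne_zero k
  refine ⟨⟨⟨2 ^ k * (j + 1 / 2), 2 ^ k * (3 / 2)⟩, by show 0 < (2 : ℝ) ^ k * (3 / 2); positivity⟩,
    mem_interior_binaryTile.2 ⟨⟨?_, ?_⟩, ?_, ?_⟩⟩
  · show (2 : ℝ) ^ k * j < 2 ^ k * (j + 1 / 2)
    nlinarith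
  · show (2 : ℝ) ^ k * (j + 1 / 2) < 2 ^ k * (j + 1)
    nlinarith
  · show (2 : ℝ) ^ k < 2 ^ k * (3 / 2)
    linarith
  · show (2 : ℝ) ^ k * (3 / 2) < 2 ^ (k + 1)
    linarith

theorem eq_of_mem_interior_binaryTile {k j k' j' : ℤ} {z : ℍ}
    (h : z ∈ interior (binaryTile k j)) (h' : z ∈ interior (binaryTile k' j')) :
    k = k' ∧ j = j' := by
  obtain ⟨⟨h1, h2⟩, h3, h4⟩ := mem_interior_binaryTile.1 h
  obtain ⟨⟨h1', h2'⟩, h3', h4'⟩ := mem_interior_binaryTile.1 h'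
  have a := (zpow_lt_zpow_iff_right₀ (one_lt_two (α := ℝ))).1 (h3.trans h4')
  have b := (zpow_lt_zpow_iff_right₀ (one_lt_two (α := ℝ))).1 (h3'.trans h4)
  obtain rfl : k = k' := by omega
  have hk : (0 : ℝ) < 2 ^ k := by positivity
  have c := lt_of_mul_lt_mul_left (h1.trans h2') hk.le
  have d := lt_of_mul_lt_mul_left (h1'.trans h2) hk.le
  norm_cast at c d
  omega

theorem exists_mem_binaryTile (z : ℍ) : ∃ k j : ℤ, z ∈ binaryTile k j := by
  have hk : (0 : ℝ) < 2 ^ Int.log 2 z.im := by positivity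
  refine ⟨Int.log 2 z.im, ⌊z.re / 2 ^ Int.log 2 z.im⌋, ⟨?_, ?_⟩, ?_, ?_⟩
  · rw [mul_comm, ← le_div_iff₀ hk]
    exact Int.floor_le _
  · rw [mul_comm, ← div_le_iff₀ hk]
    exact (Int.lt_floor_add_one _).le
  · exact_mod_cast Int.zpow_log_le_self one_lt_two z.im_pos
  · exact_mod_cast (Int.lt_zpow_succ_log_self one_lt_two z.im).le

theorem exists_isometry_binaryTile (k j k' j' : ℤ) : ∃ φ : ℍ → ℍ,
    Isometry φ ∧ Function.Surjective φ ∧ φ '' binaryTile k j = binaryTile k' j' := by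
  let a : {x : ℝ // 0 < x} := ⟨2 ^ (k' - k), by positivity⟩
  let t : ℝ := 2 ^ k' * (j' - j)
  have hsurj : Function.Surjective fun z : ℍ => t +ᵥ a • z :=
    (AddAction.surjective t).comp (MulAction.surjective a)
  refine ⟨fun z => t +ᵥ a • z, (isometry_real_vadd t).comp (isometry_pos_mul a), hsurj, ?_⟩
  have hk : (0 : ℝ) < 2 ^ k := by positivity
  have ha : (0 : ℝ) < 2 ^ (k' - k) := by positivity
  have hk' : (2 : ℝ) ^ k' = 2 ^ (k' - k) * 2 ^ k := by
    rw [← zpow_add₀ two_ne_zero]; congr 1; ring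
  have hmem : (fun z : ℍ => t +ᵥ a • z) ⁻¹' binaryTile k' j' = binaryTile k j := by
    ext z
    have e1 : (t +ᵥ a • z).re = t + 2 ^ (k' - k) * z.re := by simp [a]
    have e2 : (t +ᵥ a • z).im = 2 ^ (k' - k) * z.im := by simp [a]
    simp only [Set.mem_preimage, binaryTile, Set.mem_ofPred_eq, Set.mem_Icc, e1, e2]
    rw [zpow_add_one₀ two_ne_zero, zpow_add_one₀ two_ne_zero, hk', mul_assoc _ _ (2 : ℝ),
      mul_le_mul_iff_right₀ ha, mul_le_mul_iff_right₀ ha,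
      ← mul_le_mul_iff_right₀ ha (b := 2 ^ k * (j : ℝ)), ← mul_le_mul_iff_right₀ ha (b := z.re)]
    refine and_congr (and_congr ?_ ?_) Iff.rfl
    · constructor <;> intro h <;> simp only [t, hk'] at * <;> linarith
    · constructor <;> intro h <;> simp only [t, hk'] at * <;> linarith
  rw [← hmem, Set.image_preimage_eq _ hsurj]

theorem binaryTile_inter_right (k j : ℤ) :
    (binaryTile k j ∩ binaryTile k (j + 1)).Nonempty := by
  have h : (0 : ℝ) < 2 ^ k := by positivity
  have h' : (2 : ℝ) ^ (k + 1) = 2 ^ k * 2 := zpow_add_one₀ two_ne_zero k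
  refine ⟨⟨⟨2 ^ k * (j + 1), 2 ^ k⟩, h⟩, ⟨⟨?_, ?_⟩, ?_, ?_⟩, ⟨?_, ?_⟩, ?_, ?_⟩ <;>
    simp only [UpperHalfPlane.re, UpperHalfPlane.im] <;> push_cast <;> nlinarith

theorem binaryTile_inter_child (k j : ℤ) {i : ℤ} (hi : i = 2 * j ∨ i = 2 * j + 1) :
    (binaryTile k j ∩ binaryTile (k - 1) i).Nonempty := by
  have h : (0 : ℝ) < 2 ^ (k - 1) := by positivity
  have hk : (2 : ℝ) ^ k = 2 ^ (k - 1) * 2 := by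
    rw [← zpow_add_one₀ two_ne_zero, sub_add_cancel]
  have h' : (2 : ℝ) ^ (k + 1) = 2 ^ k * 2 := zpow_add_one₀ two_ne_zero k
  rcases hi with rfl | rfl
  · refine ⟨⟨⟨2 ^ k * j, 2 ^ k⟩, by show (0 : ℝ) < 2 ^ k; positivity⟩,
      ⟨⟨?_, ?_⟩, ?_, ?_⟩, ⟨?_, ?_⟩, ?_, ?_⟩ <;>
    simp only [UpperHalfPlane.re, UpperHalfPlane.im, h', sub_add_cancel, hk] <;>
    push_cast <;> nlinarith
  · refine ⟨⟨⟨2 ^ k * (j + 1), 2 ^ k⟩, by show (0 : ℝ) < 2 ^ k; positivity⟩,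
      ⟨⟨?_, ?_⟩, ?_, ?_⟩, ⟨?_, ?_⟩, ?_, ?_⟩ <;>
    simp only [UpperHalfPlane.re, UpperHalfPlane.im, h', sub_add_cancel, hk] <;>
    push_cast <;> nlinarith

theorem BinaryAdj.inter_nonempty {p q : ℤ × ℕ} (h : BinaryAdj p q) :
    (binaryTile p.1 p.2 ∩ binaryTile q.1 q.2).Nonempty := by
  obtain ⟨k, j⟩ := p
  obtain ⟨k', j'⟩ := q
  rcases h with ⟨h1, h2⟩ | ⟨h1, h2⟩ | ⟨h1, h2⟩ | ⟨h1, h2⟩ <;> simp only at h1 h2 ⊢ <;> subst h1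
  · subst h2
    exact_mod_cast binaryTile_inter_right k' j
  · subst h2
    rw [Set.inter_comm]
    exact_mod_cast binaryTile_inter_right k j'
  · exact binaryTile_inter_child k j (by omega)
  · rw [Set.inter_comm]
    exact binaryTile_inter_child k' j' (by omega)

theorem BinaryAdj.reflect_inter_nonempty {p q : ℤ × ℕ} (h : BinaryAdj p q) :
    (binaryTile p.1 (-p.2 - 1) ∩ binaryTile q.1 (-q.2 - 1)).Nonempty := by
  obtain ⟨k, j⟩ := p
  obtain ⟨k', j'⟩ := q
  rcases h with ⟨h1, h2⟩ | ⟨h1, h2⟩ | ⟨h1, h2⟩ | ⟨h1, h2⟩ <;> simp only at h1 h2 ⊢ <;> subst h1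
  · rw [Set.inter_comm]
    convert binaryTile_inter_right k' (-j' - 1) using 3
    omega
  · convert binaryTile_inter_right k (-j - 1) using 3
    omega
  · exact binaryTile_inter_child k _ (by omega)
  · rw [Set.inter_comm]
    exact binaryTile_inter_child k' _ (by omega)

end Tiles

/-- The two-way infinite sequence of tiles that follows `f` in the right quadrant and its mirror
image in the left quadrant. -/
def doublePath (f : ℕ → ℤ × ℕ) : ℤ → ℤ × ℤ
  | Int.ofNat n => ((f n).1, (f n).2)
  | Int.negSucc n => ((f n).1, -(f n).2 - 1)

theorem doublePath_bijective {f : ℕ → ℤ × ℕ} (hf : Function.Bijective f) :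
    Function.Bijective (doublePath f) := by
  constructor
  · rintro (m | m) (n | n) h <;> simp only [doublePath, Prod.mk.injEq] at h
    · rw [hf.1 (Prod.ext h.1 (by omega))]
    · omega
    · omega
    · rw [hf.1 (Prod.ext h.1 (by omega))]
  · rintro ⟨k, j⟩
    rcases le_or_gt 0 j with hj | hj
    · obtain ⟨n, hn⟩ := hf.2 (k, j.toNat)
      exact ⟨Int.ofNat n, Prod.ext (by simp [doublePath, hn]) (by simp [doublePath, hn, hj])⟩
    · obtain ⟨n, hn⟩ := hf.2 (k, (-j - 1).toNat)
      refine ⟨Int.negSucc n, Prod.ext (by simp [doublePath, hn]) ?_⟩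
      simp only [doublePath, hn]
      omega

theorem doublePath_inter_nonempty {f : ℕ → ℤ × ℕ} (h0 : f 0 = (0, 0))
    (hf : ∀ n, BinaryAdj (f n) (f (n + 1))) (n : ℤ) :
    (binaryTile (doublePath f n).1 (doublePath f n).2 ∩
      binaryTile (doublePath f (n + 1)).1 (doublePath f (n + 1)).2).Nonempty := by
  rcases n with n | _ | n
  · exact (hf n).inter_nonempty
  · show (binaryTile (f 0).1 (-(f 0).2 - 1) ∩ binaryTile (f 0).1 (f 0).2).Nonempty
    rw [h0]
    convert binaryTile_inter_right 0 (-1) using 3 <;> simp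
  · show (binaryTile (f (n + 1)).1 (-(f (n + 1)).2 - 1) ∩
      binaryTile (f n).1 (-(f n).2 - 1)).Nonempty
    exact (hf n).symm.reflect_inter_nonempty

/-- There is a tiling of the hyperbolic plane (upper half-plane model `ℍ` with its
hyperbolic metric) admitting a uniform plane-filling path: a family `T : ℤ → Set ℍ`
of tiles such that (i) each tile is compact with nonempty interior; (ii) any two
tiles are isometric via a surjective isometry of `ℍ`; (iii) interiors of distinct
tiles are pairwise disjoint; (iv) the tiles cover `ℍ`; and (v) consecutive tiles
`T n` and `T (n+1)` are adjacent (their intersection is nonempty). -/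
theorem exists_tiling_with_uniform_plane_filling_path :
    ∃ T : ℤ → Set UpperHalfPlane,
      (∀ n, IsCompact (T n) ∧ (interior (T n)).Nonempty) ∧
      (∀ m n, ∃ φ : UpperHalfPlane → UpperHalfPlane,
        Isometry φ ∧ Function.Surjective φ ∧ φ '' T m = T n) ∧
      (∀ m n, m ≠ n → interior (T m) ∩ interior (T n) = ∅) ∧
      (⋃ n, T n) = Set.univ ∧
      (∀ n : ℤ, (T n ∩ T (n + 1)).Nonempty) := by
  obtain ⟨f, hbij, h0, hadj⟩ := exists_quadrant_path
  have hg := doublePath_bijective hbij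
  refine ⟨fun n => binaryTile (doublePath f n).1 (doublePath f n).2,
    fun n => ⟨isCompact_binaryTile _ _, nonempty_interior_binaryTile _ _⟩,
    fun m n => exists_isometry_binaryTile _ _ _ _, ?_, ?_, doublePath_inter_nonempty h0 hadj⟩
  · intro m n hmn
    refine Set.eq_empty_of_forall_notMem fun z hz => hmn (hg.1 ?_)
    obtain ⟨h1, h2⟩ := eq_of_mem_interior_binaryTile hz.1 hz.2
    exact Prod.ext h1 h2
  · refine Set.eq_univ_of_forall fun z => ?_
    obtain ⟨k, j, hz⟩ := exists_mem_binaryTile z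
    obtain ⟨n, hn⟩ := hg.2 (k, j)
    exact Set.mem_iUnion.2 ⟨n, by simpa only [hn] using hz⟩
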